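/- arXiv:1407.3377 — 6 statements merged into one kernel-verified Lean document; each statement's English description precedes it below -/
import Mathlib

section
/- Let p : ℕ → ℕ be the parent map p(i) = ⌊(i−1)/2⌋ (with p(0) = 0). For every natural ℓ, every b ≥ 2, and every j ≥ 0, the image of the set {ℓ, ℓ+1, …, ℓ+b−1} of b consecutive indices under the j-fold iterate p^[j] has cardinality at most ⌊(b−2)/2^j⌋ + 2. (This is the claim that when a bulk of b consecutive nodes is submerged into a binary heap, the number of their ancestors at the j-th level above them is at most ⌊(b−2)/2^j⌋ + 2.) -/
/-- The parent map of a binary heap stored in an array: `p i = ⌊(i−1)/2⌋`, with `p 0 = 0`. -/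
def heapParent (i : ℕ) : ℕ := (i - 1) / 2

theorem iterate_heapParent (j i : ℕ) : heapParent^[j] i = (i + 1) / 2 ^ j - 1 := by
  induction j with
  | zero => simp
  | succ j ih =>
    rw [Function.iterate_succ_apply', ih, heapParent, pow_succ, ← Nat.div_div_eq_div_mul]
    omega

theorem Nat.add_add_one_div_le (a c : ℕ) {d : ℕ} (hd : 0 < d) :
    (a + c + 1) / d ≤ a / d + c / d + 1 := by
  refine Nat.le_of_lt_succ ((Nat.div_lt_iff_lt_mul hd).2 ?_)
  have ha := Nat.lt_mul_div_succ a hd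
  have hc := Nat.lt_mul_div_succ c hd
  nlinarith

/-- When a bulk of `b ≥ 2` consecutive nodes is submerged into a binary heap,
the number of their ancestors at the `j`-th level above them is at most
`⌊(b−2)/2^j⌋ + 2`. -/
theorem card_iterate_parent_image_le (ℓ b j : ℕ) (hb : 2 ≤ b) :
    ((Finset.Ico ℓ (ℓ + b)).image (heapParent^[j])).card ≤ (b - 2) / 2 ^ j + 2 := by
  have hsub : (Finset.Ico ℓ (ℓ + b)).image (heapParent^[j]) ⊆
      Finset.Icc ((ℓ + 1) / 2 ^ j - 1) ((ℓ + b) / 2 ^ j - 1) := by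
    intro x hx
    obtain ⟨i, hi, rfl⟩ := Finset.mem_image.1 hx
    rw [Finset.mem_Ico] at hi
    rw [iterate_heapParent, Finset.mem_Icc]
    exact ⟨Nat.sub_le_sub_right (Nat.div_le_div_right (by omega)) 1,
      Nat.sub_le_sub_right (Nat.div_le_div_right (by omega)) 1⟩
  have hcard := Finset.card_le_card hsub
  rw [Nat.card_Icc] at hcard
  have hdiv := Nat.add_add_one_div_le (ℓ + 1) (b - 2) (Nat.two_pow_pos j)
  rw [show ℓ + 1 + (b - 2) + 1 = ℓ + b by omega] at hdiv
  generalize (ℓ + 1) / 2 ^ j = m, (ℓ + b) / 2 ^ j = n, (b - 2) / 2 ^ j = k at *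
  omega
end

section
/- For every natural number i, the stretched depth satisfies s(i) ≤ 2·⌊log₂(i+1)⌋. Consequently, if the underlying complete binary tree has height h (nodes at binary depths 0,…,h−1), every node has stretched depth at most 2h−2, i.e. the stretched tree has height at most 2h−1. -/
/-- The stretched-parent map: the parent of a left child (odd index) is its
binary-tree parent, and the parent of a right child (positive even index) is
its left sibling; `sp 0 = 0`. -/
def sp (i : ℕ) : ℕ := if i % 2 = 1 then (i - 1) / 2 else i - 1

theorem sp_lt {i : ℕ} (h : 1 ≤ i) : sp i < i := by
  unfold sp; split <;> omega

/-- The stretched depth: `s 0 = 0` and `s i = s (sp i) + 1` for `i ≥ 1`. -/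
def s : ℕ → ℕ
  | 0 => 0
  | i + 1 => s (sp (i + 1)) + 1
decreasing_by exact sp_lt (by omega)

theorem s_of_pos {i : ℕ} (h : 1 ≤ i) : s i = s (sp i) + 1 := by
  obtain ⟨j, rfl⟩ := Nat.exists_eq_add_of_le' h
  rw [s]

theorem s_two_mul_add_one (k : ℕ) : s (2 * k + 1) = s k + 1 := by
  have hsp : sp (2 * k + 1) = k := by
    unfold sp; split <;> omega
  rw [s_of_pos (by omega), hsp]

theorem s_two_mul_add_two (k : ℕ) : s (2 * k + 2) = s k + 2 := by
  have hsp : sp (2 * k + 2) = 2 * k + 1 := by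
    unfold sp; split <;> omega
  rw [s_of_pos (by omega), hsp, s_two_mul_add_one]

theorem s_le_two_mul_log (i : ℕ) : s i ≤ 2 * Nat.log 2 (i + 1) := by
  induction i using Nat.strong_induction_on with
  | _ i ih =>
    rcases Nat.eq_zero_or_pos i with rfl | hi
    · simp [s]
    · have hlog : Nat.log 2 (i + 1) = Nat.log 2 ((i - 1) / 2 + 1) + 1 := by
        rw [Nat.log_of_one_lt_of_le one_lt_two (by omega)]
        congr 2
        omega
      have hk := ih ((i - 1) / 2) (by omega)
      have hs : s i ≤ s ((i - 1) / 2) + 2 := by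
        obtain hodd | heven : i = 2 * ((i - 1) / 2) + 1 ∨ i = 2 * ((i - 1) / 2) + 2 := by omega
        · have := s_two_mul_add_one ((i - 1) / 2)
          rw [← hodd] at this
          omega
        · have := s_two_mul_add_two ((i - 1) / 2)
          rw [← heven] at this
          omega
      omega

/-- Every node satisfies `s(i) ≤ 2·⌊log₂(i+1)⌋`; consequently, in a complete
binary tree of height `h` (nodes at binary depths `0,…,h−1`) every node has
stretched depth at most `2h−2`, i.e. the stretched tree has height at most `2h−1`. -/
theorem stretched_depth_le :
    (∀ i : ℕ, s i ≤ 2 * Nat.log 2 (i + 1)) ∧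
      (∀ h i : ℕ, 1 ≤ h → i < 2 ^ h - 1 → s i ≤ 2 * h - 2) := by
  refine ⟨s_le_two_mul_log, fun h i _ hi => (s_le_two_mul_log i).trans ?_⟩
  have hlog : Nat.log 2 (i + 1) < h := Nat.log_lt_of_lt_pow (by omega) (by omega)
  omega
end

section
/- For every natural number d, the stretched depth of the rightmost node at binary depth d is exactly 2d, i.e. s(2^{d+1} − 2) = 2d. (Hence the bound that a stretched tree over a complete binary tree of height h has height 2h−1 is tight.) -/
/-- The right child of `n` lies two levels below `n` in the stretched tree. -/
theorem s_right_child (n : ℕ) : s (2 * n + 2) = s n + 2 := by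
  have h₁ : sp (2 * n + 1 + 1) = 2 * n + 1 := by unfold sp; split <;> omega
  have h₂ : sp (2 * n + 1) = n := by unfold sp; split <;> omega
  rw [s, h₁, s, h₂]

/-- The stretched depth of the rightmost node at binary depth `d` is exactly `2d`;
hence the `2h−1` height bound for the stretched tree over a complete binary tree
of height `h` is tight. -/
theorem stretched_depth_rightmost (d : ℕ) : s (2 ^ (d + 1) - 2) = 2 * d := by
  induction d with
  | zero => simp [s]
  | succ d ih =>
    have h : 2 ^ (d + 1 + 1) - 2 = 2 * (2 ^ (d + 1) - 2) + 2 := by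
      have := Nat.one_le_two_pow (n := d)
      omega
    rw [h, s_right_child, ih]
    ring
end

section
/- For every natural number i, the number of indices m with 0 ≤ m < s(i) such that the m-th stretched ancestor sp^[m](i) is odd equals the binary depth ⌊log₂(i+1)⌋. (Odd indices are exactly the left children; thus on the stretched path from any node to the root, the number of left-child nodes equals the node's binary depth, which is why the stretched depth is at most twice the binary depth.) -/
theorem s_eq_add_one {i : ℕ} (h : i ≠ 0) : s i = s (sp i) + 1 := by
  obtain ⟨j, rfl⟩ := Nat.exists_eq_succ_of_ne_zero h
  rw [s]

/-- The binary depth drops by one from a left child to its stretched parent, and is unchanged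
from a right child to its stretched parent. -/
theorem log_two_add_one_eq_sp {i : ℕ} (h : i ≠ 0) :
    Nat.log 2 (i + 1) = Nat.log 2 (sp i + 1) + if i % 2 = 1 then 1 else 0 := by
  unfold sp
  split_ifs with hi
  · rw [Nat.log_of_one_lt_of_le one_lt_two (by omega),
      show (i + 1) / 2 = (i - 1) / 2 + 1 by omega]
  · rw [Nat.log_of_one_lt_of_le one_lt_two (by omega : 2 ≤ i + 1),
      Nat.log_of_one_lt_of_le one_lt_two (by omega : 2 ≤ i - 1 + 1),
      show (i + 1) / 2 = (i - 1 + 1) / 2 by omega, add_zero]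

/-- On the stretched path from any node to the root, the number of left-child
(odd-indexed) nodes equals the node's binary depth `⌊log₂(i+1)⌋`. -/
theorem count_odd_stretched_ancestors (i : ℕ) :
    ((Finset.range (s i)).filter fun m => sp^[m] i % 2 = 1).card =
      Nat.log 2 (i + 1) := by
  induction i using Nat.strong_induction_on with
  | _ i ih =>
    rcases eq_or_ne i 0 with rfl | hi
    · simp [s]
    · rw [log_two_add_one_eq_sp hi, ← ih (sp i) (sp_lt (Nat.one_le_iff_ne_zero.2 hi)),
        s_eq_add_one hi, Finset.card_filter, Finset.card_filter, Finset.sum_range_succ']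
      rfl
end

section
/- Let h ≥ 2 and n = 2^h − 1 (so the nodes 0,…,n−1 form a complete binary tree of height h). For every node i < n, the number of indices m with 0 ≤ m < s(i) such that sp^[m](i) is odd and 2·sp^[m](i) + 1 < n is at most h − 2. (In the stretched tree a node has two children exactly when it is a left child that is not a leaf of the skeleton, so this says: on any path from a node to the root of the stretched tree, the number of nodes with two children is at most h − 2.) -/
theorem s_eq_succ {i : ℕ} (hi : i ≠ 0) : s i = s (sp i) + 1 := by
  obtain ⟨j, rfl⟩ := Nat.exists_eq_succ_of_ne_zero hi
  rw [Nat.succ_eq_add_one, s]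

/-- Splitting off the first node of the path from `i` to the root. -/
theorem card_filter_iterate_sp (p : ℕ → Prop) [DecidablePred p] {i : ℕ} (hi : i ≠ 0) :
    ((Finset.range (s i)).filter fun m => p (sp^[m] i)).card =
      ((Finset.range (s (sp i))).filter fun m => p (sp^[m] (sp i))).card +
        if p i then 1 else 0 := by
  simp only [Finset.card_filter, s_eq_succ hi, Finset.sum_range_succ',
    Function.iterate_succ_apply, Function.iterate_zero_apply]
  rfl

/-- A path from a node of depth at most `k` to the root has at most `k` left children. -/
theorem card_filter_iterate_sp_le (p : ℕ → Prop) [DecidablePred p]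
    (hp : ∀ j, p j → j % 2 = 1) (i k : ℕ) (hi : i + 1 < 2 ^ (k + 1)) :
    ((Finset.range (s i)).filter fun m => p (sp^[m] i)).card ≤ k := by
  induction i using Nat.strong_induction_on generalizing k with
  | _ i ih =>
    rcases eq_or_ne i 0 with rfl | h0
    · simp [s]
    have hlt : sp i < i := sp_lt (by omega)
    rw [card_filter_iterate_sp p h0]
    by_cases hpi : p i
    · have hodd := hp i hpi
      rw [if_pos hpi]
      cases k with
      | zero => omega
      | succ k =>
        have := ih (sp i) hlt k (by rw [sp, if_pos hodd]; omega)
        omega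
    · rw [if_neg hpi]
      exact ih (sp i) hlt k (by omega)

/-- In the stretched tree over the complete binary tree with nodes `0,…,2^h−2`
(`h ≥ 2`), on any path from a node to the root the number of nodes with two
children (left children of the skeleton that are not leaves) is at most `h − 2`. -/
theorem count_binary_stretched_ancestors_le (h : ℕ) (hh : 2 ≤ h) (i : ℕ)
    (hi : i < 2 ^ h - 1) :
    ((Finset.range (s i)).filter fun m =>
        sp^[m] i % 2 = 1 ∧ 2 * sp^[m] i + 1 < 2 ^ h - 1).card ≤ h - 2 := by
  obtain ⟨k, rfl⟩ := Nat.exists_eq_add_of_le' hh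
  let p : ℕ → Prop := fun j => j % 2 = 1 ∧ 2 * j + 1 < 2 ^ (k + 2) - 1
  change ((Finset.range (s i)).filter fun m => p (sp^[m] i)).card ≤ k
  induction i using Nat.strong_induction_on with
  | _ i ih =>
    by_cases hpi : p i
    · exact card_filter_iterate_sp_le p (fun _ hj => hj.1) i k (by
        have := hpi.2
        have : 2 ^ (k + 2) = 2 ^ (k + 1) * 2 := pow_succ 2 (k + 1)
        omega)
    · rcases eq_or_ne i 0 with rfl | h0
      · simp [s]
      have hlt : sp i < i := sp_lt (by omega)
      rw [card_filter_iterate_sp p h0, if_neg hpi]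
      exact ih (sp i) hlt (by omega)
end

section
/- For all natural numbers i and j with j > 0: sp(j) = i if and only if j = 2i + 1, or j = i + 1 and i is odd. Consequently, for a stretched tree on the node set {0, …, n−1} with n ≥ 1, a node i < n has exactly two children (i.e. exactly two indices 0 < j < n with sp(j) = i) if and only if i is odd and 2i + 1 < n, that is, if and only if i is a left child of the skeleton that is not a leaf. -/
theorem sp_eq_iff {i j : ℕ} (hj : 0 < j) :
    sp j = i ↔ j = 2 * i + 1 ∨ (j = i + 1 ∧ i % 2 = 1) := by
  unfold sp
  split <;> omega

/-- Characterization of the children of a node in the stretched tree: the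
children of `i` are `2i+1` (always) and, when `i` is odd, also `i+1`.
Consequently, a node `i < n` of a stretched tree on `{0,…,n−1}` has exactly two
children iff `i` is odd and `2i+1 < n`, i.e. iff `i` is a left child of the
skeleton that is not a leaf. -/
theorem stretched_children_characterization :
    (∀ i j : ℕ, 0 < j →
        (sp j = i ↔ j = 2 * i + 1 ∨ (j = i + 1 ∧ i % 2 = 1))) ∧
      (∀ n i : ℕ, 1 ≤ n → i < n →
        (((Finset.Ioo 0 n).filter fun j => sp j = i).card = 2 ↔
          (i % 2 = 1 ∧ 2 * i + 1 < n))) := by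
  refine ⟨fun i j hj => sp_eq_iff hj, fun n i _ _ => ⟨fun h => ?_, fun ⟨hi, hn⟩ => ?_⟩⟩
  · obtain ⟨a, b, hab, hs⟩ := Finset.card_eq_two.mp h
    have mem_iff (j : ℕ) : j = a ∨ j = b ↔ (0 < j ∧ j < n) ∧ sp j = i := by
      simpa using (Finset.ext_iff.mp hs j).symm
    obtain ⟨⟨ha, han⟩, hia⟩ := (mem_iff a).mp (Or.inl rfl)
    obtain ⟨⟨hb, hbn⟩, hib⟩ := (mem_iff b).mp (Or.inr rfl)
    rw [sp_eq_iff ha] at hia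
    rw [sp_eq_iff hb] at hib
    omega
  · refine Finset.card_eq_two.mpr ⟨2 * i + 1, i + 1, by omega, ?_⟩
    ext j
    simp only [Finset.mem_filter, Finset.mem_Ioo, Finset.mem_insert, Finset.mem_singleton]
    constructor
    · rintro ⟨⟨hj, _⟩, h⟩
      have := (sp_eq_iff hj).mp h
      omega
    · intro h
      have hj : 0 < j := by omega
      exact ⟨by omega, (sp_eq_iff hj).mpr (by omega)⟩
end
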